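/- arXiv:2405.07688 — 4 statements merged into one kernel-verified Lean document; each statement's English description precedes it below -/
import Mathlib

section
/- Let G be a finitely generated group with a fixed finite symmetric generating set T, and let μ be a non-degenerate probability measure on G which generates a transient random walk. Assume that for all a,b ∈ G and for every exhaustion (S_n) of G one has Δ(S_n;a,b) → 0 as n → ∞. Then (G,μ) has the strong Liouville property: every positive μ-harmonic function on G is constant. -/
open Filter Topology

noncomputable section

/- Convolution powers of a measure `μ` on a group: `convPow μ 0 = δ_e`,
`convPow μ (n+1) x = ∑_g convPow μ n g * μ (g⁻¹ x)`. -/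
open Classical in
def convPow {G : Type*} [Group G] (μ : G → ℝ) : ℕ → G → ℝ
  | 0 => fun x => if x = 1 then 1 else 0
  | n + 1 => fun x => ∑' g : G, convPow μ n g * μ (g⁻¹ * x)

/-- The Green function `G(x,y) = ∑_{n≥0} μ^{(n)}(x⁻¹ y)`. -/
def green {G : Type*} [Group G] (μ : G → ℝ) (x y : G) : ℝ :=
  ∑' n : ℕ, convPow μ n (x⁻¹ * y)

/-- `μ` is a probability measure on `G`. -/
def IsProbMeasure {G : Type*} (μ : G → ℝ) : Prop :=
  (∀ g, 0 ≤ μ g) ∧ HasSum μ 1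

/-- `μ` is symmetric: `μ(g) = μ(g⁻¹)`. -/
def IsSymmetricMeasure {G : Type*} [Group G] (μ : G → ℝ) : Prop :=
  ∀ g : G, μ g = μ g⁻¹

/-- `μ` is non-degenerate: its support generates `G` as a semigroup. -/
def IsNonDegenerate {G : Type*} [Group G] (μ : G → ℝ) : Prop :=
  Subsemigroup.closure {g : G | μ g ≠ 0} = ⊤

/-- Transience: the Green function is finite, i.e. the series converges. -/
def IsTransient {G : Type*} [Group G] (μ : G → ℝ) : Prop :=
  ∀ x y : G, Summable fun n : ℕ => convPow μ n (x⁻¹ * y)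

/-- `f` is `μ`-harmonic: for every `k`, `∑_g μ(g) f(kg)` converges (absolutely,
since in `ℝ` summability is absolute) to `f k`. -/
def IsHarmonic {G : Type*} [Group G] (μ : G → ℝ) (f : G → ℝ) : Prop :=
  ∀ k : G, HasSum (fun g : G => μ g * f (k * g)) (f k)

/-- Word length of `x` with respect to a generating set `S`. -/
def wordLength {G : Type*} [Group G] (S : Set G) (x : G) : ℕ :=
  sInf {n : ℕ | ∃ l : List G, l.length = n ∧ (∀ a ∈ l, a ∈ S) ∧ l.prod = x}

/-- Outer boundary of `F` with respect to the generating set `T`: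
`∂F = {x ∉ F : ∃ y ∈ F, t ∈ T, x = y t}`. -/
def outerBoundary {G : Type*} [Group G] (T : Set G) (F : Set G) : Set G :=
  {x : G | x ∉ F ∧ ∃ y ∈ F, ∃ t ∈ T, x = y * t}

/-- The Green-variation functional
`Δ(F;a,b) = max_{x ∈ ∂F} |G(a,x) − G(b,x)| / G(a,x)`. -/
def greenDelta {G : Type*} [Group G] (μ : G → ℝ) (T : Set G) (F : Set G) (a b : G) : ℝ :=
  sSup ((fun x => |green μ a x - green μ b x| / green μ a x) '' outerBoundary T F)

open scoped ENNReal

open Classical in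
/-- Convolution powers of an extended nonnegative weight `m` on a group. -/
def ennConvPow {G : Type*} [Group G] (m : G → ℝ≥0∞) : ℕ → G → ℝ≥0∞
  | 0 => fun x => if x = 1 then 1 else 0
  | n + 1 => fun x => ∑' g : G, ennConvPow m n g * m (g⁻¹ * x)

/-- The Green function of the weight `m`, with values in `[0, ∞]`. -/
def ennGreen {G : Type*} [Group G] (m : G → ℝ≥0∞) (x y : G) : ℝ≥0∞ :=
  ∑' n : ℕ, ennConvPow m n (x⁻¹ * y)

/-- The Markov operator `(P u)(x) = ∑_g m(g) u(xg)`. -/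
def markovOp {G : Type*} [Group G] (m u : G → ℝ≥0∞) (x : G) : ℝ≥0∞ :=
  ∑' g : G, m g * u (x * g)

section MarkovOp

variable {G : Type*} [Group G] (m : G → ℝ≥0∞)

theorem tsum_ennConvPow (hm : ∑' g, m g = 1) (n : ℕ) : ∑' g, ennConvPow m n g = 1 := by
  induction n with
  | zero => simp [ennConvPow]
  | succ n ih =>
    simp only [ennConvPow]
    rw [ENNReal.tsum_comm]
    simp_rw [ENNReal.tsum_mul_left]
    have h (g : G) : ∑' x, m (g⁻¹ * x) = 1 := by
      rw [← hm]
      exact (Equiv.mulLeft g⁻¹).tsum_eq m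
    simp [h, ih]

theorem markovOp_iterate_apply (n : ℕ) (u : G → ℝ≥0∞) (x : G) :
    (markovOp m)^[n] u x = ∑' g, ennConvPow m n g * u (x * g) := by
  induction n generalizing u with
  | zero =>
    rw [tsum_eq_single 1]
    · simp [ennConvPow]
    · intro g hg
      simp [ennConvPow, hg]
  | succ n ih =>
    rw [Function.iterate_succ_apply, ih]
    simp only [ennConvPow, markovOp, ← ENNReal.tsum_mul_left, ← ENNReal.tsum_mul_right]
    rw [ENNReal.tsum_comm (f := fun g h => ennConvPow m n h * m (h⁻¹ * g) * u (x * g))]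
    refine tsum_congr fun h => ?_
    rw [← (Equiv.mulLeft h).tsum_eq fun g => ennConvPow m n h * m (h⁻¹ * g) * u (x * g)]
    simp [mul_assoc]

theorem markovOp_mono {u v : G → ℝ≥0∞} (h : u ≤ v) : markovOp m u ≤ markovOp m v :=
  fun x => ENNReal.tsum_le_tsum fun g => by gcongr; exact h _

theorem markovOp_iterate_add (n : ℕ) (u v : G → ℝ≥0∞) :
    (markovOp m)^[n] (u + v) = (markovOp m)^[n] u + (markovOp m)^[n] v := by
  ext x
  simp only [markovOp_iterate_apply, Pi.add_apply, mul_add, ENNReal.tsum_add]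

theorem markovOp_const_mul (c : ℝ≥0∞) (u : G → ℝ≥0∞) (x : G) :
    markovOp m (fun y => c * u y) x = c * markovOp m u x := by
  simp only [markovOp, ← ENNReal.tsum_mul_left, mul_left_comm]

theorem markovOp_iterate_const_mul (n : ℕ) (c : ℝ≥0∞) (u : G → ℝ≥0∞) (x : G) :
    (markovOp m)^[n] (fun y => c * u y) x = c * (markovOp m)^[n] u x := by
  simp only [markovOp_iterate_apply, ← ENNReal.tsum_mul_left, mul_left_comm]

/-- The potential of `v` is the sum of the iterates of the Markov operator on `v`. -/
theorem tsum_markovOp_iterate (v : G → ℝ≥0∞) (x : G) :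
    ∑' n, (markovOp m)^[n] v x = ∑' y, ennGreen m x y * v y := by
  simp only [markovOp_iterate_apply, ennGreen, ← ENNReal.tsum_mul_right]
  rw [ENNReal.tsum_comm, ← (Equiv.mulLeft x).tsum_eq fun y =>
    ∑' n, ennConvPow m n (x⁻¹ * y) * v y]
  simp

theorem markovOp_iterate_tsum (k : ℕ) (w : ℕ → G → ℝ≥0∞) (x : G) :
    (markovOp m)^[k] (fun y => ∑' n, w n y) x = ∑' n, (markovOp m)^[k] (w n) x := by
  simp only [markovOp_iterate_apply, ← ENNReal.tsum_mul_left]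
  exact ENNReal.tsum_comm

theorem ennGreen_eq_tsum_iterate (x y : G) [DecidableEq G] :
    ennGreen m x y = ∑' n, (markovOp m)^[n] (Pi.single y 1) x := by
  rw [tsum_markovOp_iterate, tsum_eq_single y]
  · simp
  · intro z hz
    simp [hz]

theorem markovOp_iterate_ennGreen (k : ℕ) (x y : G) [DecidableEq G] :
    (markovOp m)^[k] (fun z => ennGreen m z y) x
      = ∑' n, (markovOp m)^[n + k] (Pi.single y 1) x := by
  simp only [ennGreen_eq_tsum_iterate, markovOp_iterate_tsum]
  refine tsum_congr fun n => ?_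
  rw [← Function.iterate_add_apply, add_comm]

theorem markovOp_ennGreen_le (x y : G) : markovOp m (fun z => ennGreen m z y) x ≤ ennGreen m x y := by
  classical
  rw [← Function.iterate_one (markovOp m), markovOp_iterate_ennGreen, ennGreen_eq_tsum_iterate]
  exact ENNReal.tsum_comp_le_tsum_of_injective (add_left_injective 1) _

theorem tendsto_markovOp_iterate_ennGreen (x y : G) (h : ennGreen m x y ≠ ∞) :
    Tendsto (fun k => (markovOp m)^[k] (fun z => ennGreen m z y) x) atTop (𝓝 0) := by
  classical
  simp only [markovOp_iterate_ennGreen]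
  refine ENNReal.tendsto_sum_nat_add (fun n => (markovOp m)^[n] (Pi.single y 1) x) ?_
  rwa [← ennGreen_eq_tsum_iterate]

/-- Riesz representation: a finite superharmonic function dominated by a multiple of a Green
function is the potential of its charge `u - P u`. -/
theorem eq_tsum_ennGreen_mul_of_le {u : G → ℝ≥0∞} {c : ℝ≥0∞} {o : G} (hc : c ≠ ∞)
    (hfin : ∀ x, ennGreen m x o ≠ ∞) (hsup : markovOp m u ≤ u)
    (hle : ∀ x, u x ≤ c * ennGreen m x o) (x : G) :
    u x = ∑' y, ennGreen m x y * (u y - markovOp m u y) := by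
  set v : G → ℝ≥0∞ := fun y => u y - markovOp m u y with hv
  have huv : u = v + markovOp m u := by
    ext y
    exact (tsub_add_cancel_of_le (hsup y)).symm
  have hsum (k : ℕ) :
      u x = ∑ n ∈ Finset.range k, (markovOp m)^[n] v x + (markovOp m)^[k] u x := by
    induction k with
    | zero => simp
    | succ k ih =>
      have hstep : (markovOp m)^[k] u x
          = (markovOp m)^[k] v x + (markovOp m)^[k + 1] u x := by
        conv_lhs => rw [huv, markovOp_iterate_add]
        rfl
      rw [Finset.sum_range_succ, add_assoc, ← hstep, ← ih]
  have hrem : Tendsto (fun k => (markovOp m)^[k] u x) atTop (𝓝 0) := by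
    have hlim : Tendsto (fun k => c * (markovOp m)^[k] (fun z => ennGreen m z o) x) atTop (𝓝 0) := by
      simpa using ENNReal.Tendsto.const_mul
        (tendsto_markovOp_iterate_ennGreen m x o (hfin x)) (Or.inr hc)
    refine tendsto_of_tendsto_of_tendsto_of_le_of_le tendsto_const_nhds hlim
      (fun _ => zero_le) fun k => ?_
    simp only [← markovOp_iterate_const_mul]
    simp only [markovOp_iterate_apply]
    exact ENNReal.tsum_le_tsum fun g => by gcongr; exact hle _
  have hlim := (ENNReal.tendsto_nat_tsum fun n => (markovOp m)^[n] v x).add hrem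
  rw [tsum_markovOp_iterate, add_zero] at hlim
  refine tendsto_nhds_unique ?_ hlim
  simp only [← hsum]
  exact tendsto_const_nhds

theorem tendsto_markovOp_of_dominated {u : ℕ → G → ℝ≥0∞} {f : G → ℝ≥0∞} (x : G)
    (hf : markovOp m f x ≠ ∞) (hm : ∀ g, m g ≠ ∞) (hle : ∀ n, u n ≤ f)
    (hlim : ∀ y, Tendsto (fun n => u n y) atTop (𝓝 (f y))) :
    Tendsto (fun n => markovOp m (u n) x) atTop (𝓝 (markovOp m f x)) := by
  let _ : MeasurableSpace G := ⊤
  simp only [markovOp, ← MeasureTheory.lintegral_count] at hf ⊢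
  refine MeasureTheory.tendsto_lintegral_of_dominated_convergence _
    (fun n => measurable_from_top) (fun n => .of_forall fun g => ?_) hf (.of_forall fun g => ?_)
  · dsimp only
    gcongr
    exact hle n _
  · exact ENNReal.Tendsto.const_mul (hlim _) (Or.inr (hm g))

/-- If Green functions based at `b` are asymptotically at most those based at `a`, then every
finite harmonic function satisfies `f b ≤ f a`. -/
theorem harmonic_le_of_ennGreen_le {f : G → ℝ≥0∞} (hf : markovOp m f = f)
    (hffin : ∀ x, f x ≠ ∞) (hm : ∀ g, m g ≠ ∞) (hfin : ∀ x y, ennGreen m x y ≠ ∞)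
    (hpos : ∀ x y, ennGreen m x y ≠ 0) {a b : G}
    (hab : ∀ ε : ℝ, 0 < ε →
      {y | ¬ ennGreen m b y ≤ ENNReal.ofReal (1 + ε) * ennGreen m a y}.Finite) :
    f b ≤ f a := by
  set u : ℕ → G → ℝ≥0∞ := fun n x => min (f x) (n * ennGreen m x 1) with hu
  have hule (n : ℕ) : u n ≤ f := fun x => min_le_left _ _
  have hueq (x : G) : ∀ᶠ n in atTop, u n x = f x := by
    obtain ⟨N, hN⟩ := ENNReal.exists_nat_mul_gt (hpos x 1) (hffin x)
    filter_upwards [eventually_ge_atTop N] with n hn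
    refine min_eq_left (hN.le.trans ?_)
    gcongr
  have hulim (x : G) : Tendsto (fun n => u n x) atTop (𝓝 (f x)) :=
    tendsto_const_nhds.congr' ((hueq x).mono fun _ h => h.symm)
  have husup (n : ℕ) : markovOp m (u n) ≤ u n := by
    intro x
    refine le_min ((markovOp_mono m (hule n) x).trans_eq (congrFun hf x)) ?_
    calc markovOp m (u n) x ≤ markovOp m (fun y => n * ennGreen m y 1) x :=
          markovOp_mono m (fun y => min_le_right _ _) x
      _ = n * markovOp m (fun y => ennGreen m y 1) x := markovOp_const_mul m _ _ x
      _ ≤ n * ennGreen m x 1 := by gcongr; exact markovOp_ennGreen_le m x 1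
  set v : ℕ → G → ℝ≥0∞ := fun n y => u n y - markovOp m (u n) y with hv
  have hrep (n : ℕ) (x : G) : u n x = ∑' y, ennGreen m x y * v n y :=
    eq_tsum_ennGreen_mul_of_le m (ENNReal.natCast_ne_top n) (fun x => hfin x 1) (husup n)
      (fun x => min_le_right _ _) x
  have hvlim (y : G) : Tendsto (fun n => v n y) atTop (𝓝 0) := by
    have hP := tendsto_markovOp_of_dominated m y (by rw [hf]; exact hffin y) hm hule hulim
    rw [hf] at hP
    simpa using ENNReal.Tendsto.sub (hulim y) hP (Or.inl (hffin y))
  have hbound (ε : ℝ) (hε : 0 < ε) : f b ≤ ENNReal.ofReal (1 + ε) * f a := by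
    set E := (hab ε hε).toFinset with hE
    have hn (n : ℕ) : u n b
        ≤ ∑ y ∈ E, ennGreen m b y * v n y + ENNReal.ofReal (1 + ε) * u n a := by
      rw [hrep n b, hrep n a, ← ENNReal.tsum_mul_left, sum_eq_tsum_indicator, ← ENNReal.tsum_add]
      refine ENNReal.tsum_le_tsum fun y => ?_
      by_cases hy : y ∈ E
      · rw [Set.indicator_of_mem (by simpa using hy)]
        exact le_self_add
      · rw [Set.indicator_of_notMem (by simpa using hy), zero_add, ← mul_assoc]
        gcongr
        simpa [hE] using hy
    have hlim : Tendsto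
        (fun n => ∑ y ∈ E, ennGreen m b y * v n y + ENNReal.ofReal (1 + ε) * u n a) atTop
        (𝓝 (∑ y ∈ E, ennGreen m b y * 0 + ENNReal.ofReal (1 + ε) * f a)) :=
      (tendsto_finsetSum E fun y _ =>
        ENNReal.Tendsto.const_mul (hvlim y) (Or.inr (hfin b y))).add
        (ENNReal.Tendsto.const_mul (hulim a) (Or.inr ENNReal.ofReal_ne_top))
    simpa using le_of_tendsto_of_tendsto' (hulim b) hlim hn
  have hlim : Tendsto (fun ε : ℝ => ENNReal.ofReal (1 + ε) * f a) (𝓝[>] 0) (𝓝 (f a)) := by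
    have h1 : Tendsto (fun ε : ℝ => ENNReal.ofReal (1 + ε)) (𝓝[>] 0) (𝓝 1) := by
      have : Continuous fun ε : ℝ => ENNReal.ofReal (1 + ε) :=
        ENNReal.continuous_ofReal.comp (by fun_prop)
      simpa using (this.tendsto 0).mono_left nhdsWithin_le_nhds
    simpa using ENNReal.Tendsto.mul_const h1 (Or.inr (hffin a))
  exact ge_of_tendsto hlim (eventually_mem_nhdsWithin.mono hbound)

theorem exists_ennConvPow_ne_zero (hnd : Subsemigroup.closure {g | m g ≠ 0} = ⊤) (g : G) :
    ∃ n, ennConvPow m n g ≠ 0 := by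
  have key : ∀ h, ∀ n, ennConvPow m n h ≠ 0 → ∃ k, ennConvPow m k (h * g) ≠ 0 := by
    have hg : g ∈ Subsemigroup.closure {g | m g ≠ 0} := hnd ▸ Subsemigroup.mem_top g
    induction hg using Subsemigroup.closure_induction with
    | mem x hx =>
      intro h n hn
      refine ⟨n + 1, fun h0 => ?_⟩
      simp only [ennConvPow, ENNReal.tsum_eq_zero] at h0
      have := h0 h
      rw [inv_mul_cancel_left] at this
      exact mul_ne_zero hn hx this
    | mul x y _ _ ihx ihy =>
      intro h n hn
      obtain ⟨k, hk⟩ := ihx h n hn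
      simpa [mul_assoc] using ihy _ k hk
  simpa using key 1 0 (by simp [ennConvPow])

theorem ennGreen_ne_zero (hnd : Subsemigroup.closure {g | m g ≠ 0} = ⊤) (x y : G) :
    ennGreen m x y ≠ 0 := by
  obtain ⟨n, hn⟩ := exists_ennConvPow_ne_zero m hnd (x⁻¹ * y)
  exact fun h => hn (ENNReal.tsum_eq_zero.mp h n)

end MarkovOp

theorem convPow_nonneg {G : Type*} [Group G] {μ : G → ℝ} (h : IsProbMeasure μ) (n : ℕ) (x : G) :
    0 ≤ convPow μ n x := by
  induction n generalizing x with
  | zero => simp only [convPow]; split_ifs <;> norm_num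
  | succ n ih => exact tsum_nonneg fun g => mul_nonneg (ih g) (h.1 _)

theorem IsProbMeasure.tsum_ofReal {G : Type*} {μ : G → ℝ} (h : IsProbMeasure μ) :
    ∑' g, ENNReal.ofReal (μ g) = 1 := by
  rw [← ENNReal.ofReal_tsum_of_nonneg h.1 h.2.summable, h.2.tsum_eq, ENNReal.ofReal_one]

theorem ofReal_convPow {G : Type*} [Group G] {μ : G → ℝ} (h : IsProbMeasure μ) (n : ℕ) (x : G) :
    ENNReal.ofReal (convPow μ n x) = ennConvPow (fun g => ENNReal.ofReal (μ g)) n x := by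
  induction n generalizing x with
  | zero =>
    by_cases hx : x = 1 <;> simp [convPow, ennConvPow, hx]
  | succ n ih =>
    have hμ (g : G) : μ g ≤ 1 := le_hasSum h.2 g fun _ _ => h.1 _
    have hsum : Summable (convPow μ n) := by
      have hone := tsum_ennConvPow _ h.tsum_ofReal n
      simp only [← ih] at hone
      refine (ENNReal.summable_toReal (hone ▸ ENNReal.one_ne_top)).congr fun g => ?_
      exact ENNReal.toReal_ofReal (convPow_nonneg h n g)
    simp only [convPow, ennConvPow]
    rw [ENNReal.ofReal_tsum_of_nonneg fun g => mul_nonneg (convPow_nonneg h n g) (h.1 _)]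
    · exact tsum_congr fun g => by rw [ENNReal.ofReal_mul (convPow_nonneg h n g), ih]
    · exact hsum.of_nonneg_of_le (fun g => mul_nonneg (convPow_nonneg h n g) (h.1 _))
        fun g => mul_le_of_le_one_right (convPow_nonneg h n g) (hμ _)

theorem ofReal_green {G : Type*} [Group G] {μ : G → ℝ} (h : IsProbMeasure μ)
    (htr : IsTransient μ) (x y : G) :
    ENNReal.ofReal (green μ x y) = ennGreen (fun g => ENNReal.ofReal (μ g)) x y := by
  simp only [green, ennGreen, ← ofReal_convPow h]
  exact ENNReal.ofReal_tsum_of_nonneg (fun n => convPow_nonneg h n _) (htr x y)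

theorem IsHarmonic.markovOp_ofReal {G : Type*} [Group G] {μ f : G → ℝ} (h : IsProbMeasure μ)
    (hf : ∀ x, 0 ≤ f x) (hfh : IsHarmonic μ f) :
    markovOp (fun g => ENNReal.ofReal (μ g)) (fun x => ENNReal.ofReal (f x))
      = fun x => ENNReal.ofReal (f x) := by
  ext x
  simp only [markovOp, ← ENNReal.ofReal_mul (h.1 _)]
  rw [← ENNReal.ofReal_tsum_of_nonneg (fun g => mul_nonneg (h.1 g) (hf _)) (hfh x).summable,
    (hfh x).tsum_eq]

theorem outerBoundary_finite {G : Type*} [Group G] (T F : Finset G) :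
    (outerBoundary (T : Set G) (F : Set G)).Finite := by
  refine (Set.Finite.image2 (fun y t => y * t) F.finite_toSet T.finite_toSet).subset ?_
  rintro x ⟨-, y, hy, t, ht, rfl⟩
  exact ⟨y, hy, t, ht, rfl⟩

/-- For every infinite set `B`, there is an exhaustion by finite sets, each of which, from the
second one on, has a point of `B` in its outer boundary. -/
theorem exists_exhaustion_outerBoundary {G : Type*} [Group G] [Countable G] {T : Set G} {t : G}
    (ht : t ∈ T) (ht1 : t ≠ 1) {B : Set G} (hB : B.Infinite) :
    ∃ S : ℕ → Finset G, Monotone S ∧ (∀ g, ∃ n, g ∈ S n) ∧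
      ∀ n, ∃ x ∈ B, x ∈ outerBoundary T (S (n + 1) : Set G) := by
  classical
  have hext (F : Finset G) :
      ∃ F' : Finset G, F ⊆ F' ∧ ∃ x ∈ B, x ∈ outerBoundary T (F' : Set G) := by
    obtain ⟨x, hxB, hxF⟩ := hB.exists_notMem_finset F
    refine ⟨insert (x * t⁻¹) F, Finset.subset_insert _ _, x, hxB, ?_, x * t⁻¹, by simp, t, ht,
      by simp⟩
    simp [hxF, ht1]
  choose φ hφ hφB using hext
  obtain ⟨e, he⟩ := exists_surjective_nat G
  let S : ℕ → Finset G := fun n => Nat.rec ∅ (fun k F => φ (insert (e k) F)) n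
  have hS (n : ℕ) : insert (e n) (S n) ⊆ S (n + 1) := hφ _
  refine ⟨S, monotone_nat_of_le_succ fun n => (Finset.subset_insert _ _).trans (hS n),
    fun g => ?_, fun n => hφB _⟩
  obtain ⟨n, rfl⟩ := he g
  exact ⟨n + 1, hS n (Finset.mem_insert_self _ _)⟩

theorem finite_setOf_lt_green_variation {G : Type*} [Group G] [Countable G] {μ : G → ℝ}
    {T : Finset G} {t : G} (ht : t ∈ T) (ht1 : t ≠ 1) {a b : G}
    (hΔ : ∀ Sn : ℕ → Finset G, Monotone Sn → (∀ g : G, ∃ n, g ∈ Sn n) →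
      Tendsto (fun n => greenDelta μ (T : Set G) (Sn n : Set G) a b) atTop (nhds 0))
    {ε : ℝ} (hε : 0 < ε) :
    {x | ε < |green μ a x - green μ b x| / green μ a x}.Finite := by
  by_contra hinf
  obtain ⟨S, hmono, hex, hS⟩ :=
    exists_exhaustion_outerBoundary (T := (T : Set G)) (by simpa using ht) ht1 hinf
  have hlim := (tendsto_add_atTop_iff_nat 1).mpr (hΔ S hmono hex)
  refine hε.not_ge (ge_of_tendsto' hlim fun n => ?_)
  obtain ⟨x, hx, hxS⟩ := hS n
  exact (le_of_lt hx).trans <| le_csSup ((outerBoundary_finite T (S (n + 1))).image _).bddAbove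
    ⟨x, hxS, rfl⟩

/-- If `Δ(S_n;a,b) → 0` for all basepoints and all exhaustions,
then `(G,μ)` has the strong Liouville property. -/
theorem delta_tendsto_zero_implies_strongLiouville
    {G : Type*} [Group G] (hFG : Group.FG G) (μ : G → ℝ)
    (T : Finset G) (hTsym : ∀ t ∈ T, t⁻¹ ∈ T)
    (hTgen : Subgroup.closure (T : Set G) = ⊤)
    (hprob : IsProbMeasure μ) (hnd : IsNonDegenerate μ) (htr : IsTransient μ)
    (hΔ : ∀ a b : G, ∀ Sn : ℕ → Finset G, Monotone Sn → (∀ g : G, ∃ n, g ∈ Sn n) →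
      Tendsto (fun n => greenDelta μ (T : Set G) (Sn n : Set G) a b) atTop (nhds 0)) :
    ∀ f : G → ℝ, (∀ x, 0 < f x) → IsHarmonic μ f → ∀ x y : G, f x = f y := by
  intro f hf hfh x y
  rcases subsingleton_or_nontrivial G with hG | hG
  · rw [Subsingleton.elim x y]
  have hcount : Countable G := by
    obtain ⟨α, hα, φ, hφ⟩ := Group.fg_iff_exists_freeGroup_hom_surjective_finite.mp hFG
    exact hφ.countable
  obtain ⟨t, ht, ht1⟩ : ∃ t ∈ T, t ≠ 1 := by
    by_contra! h
    exact bot_ne_top (α := Subgroup G) <| hTgen ▸ (Subgroup.closure_eq_bot_iff.mpr h).symm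
  set m : G → ℝ≥0∞ := fun g => ENNReal.ofReal (μ g) with hm
  have hsupp : {g | m g ≠ 0} = {g | μ g ≠ 0} := by
    ext g
    simpa [hm] using (hprob.1 g).lt_iff_ne'
  have hpos : ∀ x y, ennGreen m x y ≠ 0 := ennGreen_ne_zero m (hsupp ▸ hnd)
  have hfin : ∀ x y, ennGreen m x y ≠ ∞ := fun x y => by
    rw [← ofReal_green hprob htr]
    exact ENNReal.ofReal_ne_top
  have hgreen (x y : G) : 0 < green μ x y := by
    rw [← ENNReal.ofReal_pos, ofReal_green hprob htr]
    exact (hpos x y).bot_lt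
  have hle (a b : G) : f b ≤ f a := by
    rw [← ENNReal.ofReal_le_ofReal_iff (hf a).le]
    refine harmonic_le_of_ennGreen_le m (hfh.markovOp_ofReal hprob fun x => (hf x).le)
      (fun _ => ENNReal.ofReal_ne_top) (fun _ => ENNReal.ofReal_ne_top) hfin hpos fun ε hε => ?_
    refine (finite_setOf_lt_green_variation ht ht1 (hΔ a b) hε).subset fun z hz => ?_
    simp only [Set.mem_ofPred_eq] at hz ⊢
    contrapose! hz
    rw [div_le_iff₀ (hgreen a z)] at hz
    rw [← ofReal_green hprob htr, ← ofReal_green hprob htr, ← ENNReal.ofReal_mul (by positivity)]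
    refine ENNReal.ofReal_le_ofReal ?_
    linarith [(abs_le.mp hz).1]
  exact le_antisymm (hle y x) (hle x y)
end
end

section
/- Let μ be a finitely supported, non-degenerate probability measure (not necessarily symmetric) on an infinite finitely generated group G. Suppose there exists a non-constant minimal positive μ-harmonic function h with subexponential upper growth: for every ε > 0 there is C_ε > 0 such that |h(x)| ≤ C_ε e^{ε|x|} for all x ∈ G. Then there exist infinitely many pairwise distinct minimal positive μ-harmonic functions, each with the same subexponential upper growth property. -/
open Filter Topology

noncomputable section

/-- `h` is a minimal positive `μ`-harmonic function. -/
def IsMinimalHarmonic {G : Type*} [Group G] (μ : G → ℝ) (h : G → ℝ) : Prop :=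
  (∀ x, 0 < h x) ∧ IsHarmonic μ h ∧
    ∀ u : G → ℝ, (∀ x, 0 < u x) → IsHarmonic μ u → (∀ x, u x ≤ h x) →
      ∃ c > (0:ℝ), ∀ x, u x = c * h x
/-- Subexponential upper growth of `u` with respect to the word length of `S`. -/
def HasSubexpGrowth {G : Type*} [Group G] (S : Set G) (u : G → ℝ) : Prop :=
  ∀ ε > (0:ℝ), ∃ C > (0:ℝ), ∀ x : G, |u x| ≤ C * Real.exp (ε * (wordLength S x : ℝ))

section WordLength

variable {G : Type*} [Group G] {S : Set G}

theorem exists_list_length_eq_wordLength (hSsym : ∀ s ∈ S, s⁻¹ ∈ S)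
    (hSgen : Subgroup.closure S = ⊤) (x : G) :
    ∃ l : List G, l.length = wordLength S x ∧ (∀ a ∈ l, a ∈ S) ∧ l.prod = x := by
  have hx : x ∈ Submonoid.closure (S ∪ S⁻¹) := by
    rw [← Subgroup.closure_toSubmonoid, hSgen]
    exact Submonoid.mem_top x
  obtain ⟨l, hl, hprod⟩ := Submonoid.exists_list_of_mem_closure hx
  have hne : {n : ℕ | ∃ l : List G, l.length = n ∧ (∀ a ∈ l, a ∈ S) ∧ l.prod = x}.Nonempty :=
    ⟨l.length, l, rfl, fun a ha => (hl a ha).elim id fun h => inv_inv a ▸ hSsym _ h, hprod⟩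
  exact Nat.sInf_mem hne

theorem wordLength_one : wordLength S (1 : G) = 0 :=
  Nat.le_zero.mp (Nat.sInf_le ⟨[], by simp⟩)

theorem wordLength_mul_le (hSsym : ∀ s ∈ S, s⁻¹ ∈ S) (hSgen : Subgroup.closure S = ⊤)
    (x y : G) : wordLength S (x * y) ≤ wordLength S x + wordLength S y := by
  obtain ⟨l, hl, hlS, hlx⟩ := exists_list_length_eq_wordLength hSsym hSgen x
  obtain ⟨m, hm, hmS, hmy⟩ := exists_list_length_eq_wordLength hSsym hSgen y
  refine Nat.sInf_le ⟨l ++ m, by simp [hl, hm], fun a ha => ?_, by simp [hlx, hmy]⟩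
  exact (List.mem_append.mp ha).elim (hlS a) (hmS a)

theorem wordLength_pow_le (hSsym : ∀ s ∈ S, s⁻¹ ∈ S) (hSgen : Subgroup.closure S = ⊤)
    (x : G) (n : ℕ) : wordLength S (x ^ n) ≤ n * wordLength S x := by
  induction n with
  | zero => simp [wordLength_one]
  | succ n ih =>
    rw [pow_succ, Nat.succ_mul]
    exact (wordLength_mul_le hSsym hSgen _ _).trans (Nat.add_le_add_right ih _)

theorem HasSubexpGrowth.const_mul_translate (hSsym : ∀ s ∈ S, s⁻¹ ∈ S)
    (hSgen : Subgroup.closure S = ⊤) {u : G → ℝ} (hu : HasSubexpGrowth S u)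
    {c : ℝ} (hc : 0 < c) (g : G) : HasSubexpGrowth S fun x => c * u (g * x) := by
  intro ε hε
  obtain ⟨C, hC, hb⟩ := hu ε hε
  refine ⟨c * (C * Real.exp (ε * wordLength S g)), by positivity, fun x => ?_⟩
  rw [abs_mul, abs_of_pos hc, mul_assoc, mul_assoc, ← Real.exp_add, ← mul_add]
  refine mul_le_mul_of_nonneg_left ((hb _).trans ?_) hc.le
  gcongr
  exact_mod_cast wordLength_mul_le hSsym hSgen g x

/-- A multiplier of a positive function of subexponential growth is at most one. -/
theorem HasSubexpGrowth.multiplier_le_one (hSsym : ∀ s ∈ S, s⁻¹ ∈ S)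
    (hSgen : Subgroup.closure S = ⊤) {u : G → ℝ} (hu : HasSubexpGrowth S u) (hpos : 0 < u 1)
    {g : G} {c : ℝ} (hg : ∀ x, u (g * x) = c * u x) : c ≤ 1 := by
  by_contra! hc
  have hlog : 0 < Real.log c := Real.log_pos hc
  have hpow : ∀ n : ℕ, u (g ^ n) = c ^ n * u 1 := by
    intro n
    induction n with
    | zero => simp
    | succ n ih => rw [pow_succ', hg, ih]; ring
  set L : ℝ := (wordLength S g : ℝ) with hL
  have hL0 : 0 ≤ L := Nat.cast_nonneg _
  obtain ⟨C, hC, hb⟩ := hu (Real.log c / (2 * (L + 1))) (by positivity)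
  have hεL : Real.log c / (2 * (L + 1)) * L ≤ Real.log c / 2 := by
    rw [div_mul_eq_mul_div, div_le_div_iff₀ (by positivity) two_pos]
    nlinarith
  obtain ⟨n, hn⟩ := pow_unbounded_of_one_lt (C / u 1)
    (Real.one_lt_exp_iff.mpr (half_pos hlog))
  have hlen : (wordLength S (g ^ n) : ℝ) ≤ n * L := by
    rw [hL]
    exact_mod_cast wordLength_pow_le hSsym hSgen g n
  have hexp : Real.exp (Real.log c / (2 * (L + 1)) * wordLength S (g ^ n))
      ≤ Real.exp (Real.log c / 2) ^ n := by
    rw [← Real.exp_nat_mul]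
    refine Real.exp_le_exp.mpr ?_
    calc Real.log c / (2 * (L + 1)) * wordLength S (g ^ n)
        ≤ Real.log c / (2 * (L + 1)) * (n * L) := by gcongr
      _ = n * (Real.log c / (2 * (L + 1)) * L) := by ring
      _ ≤ n * (Real.log c / 2) := by gcongr
  have hcr : c = Real.exp (Real.log c / 2) * Real.exp (Real.log c / 2) := by
    rw [← Real.exp_add, add_halves, Real.exp_log (by linarith)]
  set r := Real.exp (Real.log c / 2) with hr
  have hrn : 0 < r ^ n := by positivity
  have hbound : c ^ n * u 1 ≤ C * r ^ n := by
    rw [← hpow]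
    exact (le_abs_self _).trans ((hb _).trans (by gcongr))
  rw [hcr, mul_pow] at hbound
  rw [div_lt_iff₀ hpos] at hn
  nlinarith

end WordLength

section Harmonic

variable {G : Type*} [Group G] {μ : G → ℝ}

theorem IsHarmonic.const_mul_translate {u : G → ℝ} (hu : IsHarmonic μ u) (c : ℝ) (g : G) :
    IsHarmonic μ fun x => c * u (g * x) := by
  intro k
  have hfun : (fun x => μ x * (c * u (g * (k * x)))) = fun x => c * (μ x * u (g * k * x)) := by
    funext x
    rw [← mul_assoc g k x]
    ring
  exact hfun ▸ (hu (g * k)).mul_left c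

theorem IsMinimalHarmonic.const_mul_translate {u : G → ℝ} (hu : IsMinimalHarmonic μ u)
    {c : ℝ} (hc : 0 < c) (g : G) : IsMinimalHarmonic μ fun x => c * u (g * x) := by
  obtain ⟨hpos, hharm, hmin⟩ := hu
  refine ⟨fun x => mul_pos hc (hpos _), hharm.const_mul_translate c g, fun v hv hvh hle => ?_⟩
  obtain ⟨d, hd, hdv⟩ := hmin (fun x => c⁻¹ * v (g⁻¹ * x))
    (fun x => mul_pos (inv_pos.mpr hc) (hv _)) (hvh.const_mul_translate _ _) (fun x => by
      rw [inv_mul_le_iff₀ hc]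
      simpa using hle (g⁻¹ * x))
  refine ⟨d, hd, fun x => ?_⟩
  have hx := hdv (g * x)
  rw [inv_mul_cancel_left, inv_mul_eq_iff_eq_mul₀ hc.ne'] at hx
  rw [hx]
  ring

/-- Maximum principle: a harmonic function attaining its maximum is constant. -/
theorem IsHarmonic.eq_of_forall_le (hprob : IsProbMeasure μ) (hnd : IsNonDegenerate μ)
    {u : G → ℝ} (hu : IsHarmonic μ u) {a : G} (ha : ∀ x, u x ≤ u a) (x : G) : u x = u a := by
  have step : ∀ g : G, μ g ≠ 0 → ∀ k, u k = u a → u (k * g) = u a := by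
    intro g hg k hk
    have hsum : HasSum (fun g => μ g * (u a - u (k * g))) 0 := by
      have := (hprob.2.mul_right (u a)).sub (hu k)
      simpa only [one_mul, hk, sub_self, ← mul_sub] using this
    have hzero := (hasSum_zero_iff_of_nonneg
      fun g => mul_nonneg (hprob.1 g) (sub_nonneg.mpr (ha (k * g)))).mp hsum
    have hmul : μ g * (u a - u (k * g)) = 0 := congrFun hzero g
    exact (sub_eq_zero.mp ((mul_eq_zero.mp hmul).resolve_left hg)).symm
  have hall : ∀ g : G, ∀ k, u k = u a → u (k * g) = u a := by
    intro g
    have hg : g ∈ Subsemigroup.closure {g : G | μ g ≠ 0} := by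
      rw [show Subsemigroup.closure {g : G | μ g ≠ 0} = ⊤ from hnd]
      exact Subsemigroup.mem_top g
    induction hg using Subsemigroup.closure_induction with
    | mem g hg => exact step g hg
    | mul g g' _ _ ihg ihg' =>
      intro k hk
      rw [← mul_assoc]
      exact ihg' _ (ihg k hk)
  simpa using hall (a⁻¹ * x) a rfl

/-- Already the minimal harmonic functions normalized at the identity are infinitely many, so
the functions found are not just multiples of one another. -/
theorem infinite_normalized_minimal_harmonic {S : Set G} (hSsym : ∀ s ∈ S, s⁻¹ ∈ S)
    (hSgen : Subgroup.closure S = ⊤) (hprob : IsProbMeasure μ) (hnd : IsNonDegenerate μ)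
    {h : G → ℝ} (hmin : IsMinimalHarmonic μ h) (hnc : ¬ ∀ x y : G, h x = h y)
    (hsub : HasSubexpGrowth S h) :
    {u : G → ℝ | u 1 = 1 ∧ IsMinimalHarmonic μ u ∧ HasSubexpGrowth S u}.Infinite := by
  intro hfinite
  have hpos := hmin.1
  set φ : G → G → ℝ := fun g x => (h g)⁻¹ * h (g * x) with hφ
  have hmem : Set.range φ ⊆
      {u : G → ℝ | u 1 = 1 ∧ IsMinimalHarmonic μ u ∧ HasSubexpGrowth S u} := by
    rintro _ ⟨g, rfl⟩
    have hg := inv_pos.mpr (hpos g)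
    exact ⟨by simp [hφ, (hpos g).ne'], hmin.const_mul_translate hg g,
      hsub.const_mul_translate hSsym hSgen hg g⟩
  have hle : ∀ a b, φ a = φ b → h b ≤ h a := by
    intro a b hab
    have hmult : ∀ x, h (b * a⁻¹ * x) = h b / h a * h x := by
      intro x
      have hx : (h a)⁻¹ * h (a * (a⁻¹ * x)) = (h b)⁻¹ * h (b * (a⁻¹ * x)) :=
        congrFun hab (a⁻¹ * x)
      rw [mul_inv_cancel_left, ← mul_assoc b] at hx
      have := (hpos b).ne'
      field_simp at hx ⊢
      linarith
    exact (div_le_one (hpos a)).mp (hsub.multiplier_le_one hSsym hSgen (hpos 1) hmult)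
  have hrange : (Set.range h).Finite := by
    have hfactor : h = (fun u => h (Function.invFun φ u)) ∘ φ := by
      funext g
      have hg : φ (Function.invFun φ (φ g)) = φ g := Function.invFun_eq ⟨g, rfl⟩
      exact le_antisymm (hle _ _ hg) (hle _ _ hg.symm)
    rw [hfactor, Set.range_comp]
    exact (hfinite.subset hmem).image _
  obtain ⟨_, ⟨a, rfl⟩, ha⟩ := hrange.exists_maximal (Set.range_nonempty h)
  have hmax : ∀ x, h x ≤ h a := fun x => not_lt.mp fun hx => hx.not_ge (ha ⟨x, rfl⟩ hx.le)
  have hconst := hmin.2.1.eq_of_forall_le hprob hnd hmax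
  exact hnc fun x y => (hconst x).trans (hconst y).symm

end Harmonic

/-- Abundance under subexponential upper growth, without symmetry:
a non-constant minimal harmonic function of subexponential growth forces infinitely
many minimal harmonic functions with the same subexponential upper growth. -/
theorem abundance_of_subexponential_minimal_harmonic
    {G : Type*} [Group G] [Infinite G] (μ : G → ℝ)
    (S : Finset G) (hSsym : ∀ s ∈ S, s⁻¹ ∈ S)
    (hSgen : Subgroup.closure (S : Set G) = ⊤)
    (hprob : IsProbMeasure μ) (hnd : IsNonDegenerate μ)
    (hfin : (Function.support μ).Finite)
    (h : G → ℝ) (hmin : IsMinimalHarmonic μ h) (hnc : ¬ ∀ x y : G, h x = h y)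
    (hsub : ∀ ε > (0:ℝ), ∃ C > (0:ℝ), ∀ x : G,
      |h x| ≤ C * Real.exp (ε * (wordLength (S : Set G) x : ℝ))) :
    {u : G → ℝ | IsMinimalHarmonic μ u ∧
      ∀ ε > (0:ℝ), ∃ C > (0:ℝ), ∀ x : G,
        |u x| ≤ C * Real.exp (ε * (wordLength (S : Set G) x : ℝ))}.Infinite := by
  exact (infinite_normalized_minimal_harmonic (S := (S : Set G)) (fun s hs => hSsym s hs) hSgen
    hprob hnd hmin hnc hsub).mono fun _ hu => hu.2
end
end

section
/- In the graph/kernel setting below, assume hypotheses (HK) and (IH). Then there exists C_UH > 0 such that for all n ≥ 1 and all x, a, b ∈ 𝔾: |p_n(a,x) − p_n(b,x)| ≤ C_UH (d(a,b)/ρ(n))^α · Vol(ρ(n))^{-1}. -/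
open Filter Topology

noncomputable section

/- Iterates of a Markov kernel `p` on a countable vertex set:
`kerPow p 0 = δ`, `kerPow p (n+1) x y = ∑_z kerPow p n x z * p z y`. -/
open Classical in
def kerPow {V : Type*} (p : V → V → ℝ) : ℕ → V → V → ℝ
  | 0 => fun x y => if x = y then 1 else 0
  | n + 1 => fun x y => ∑' z : V, kerPow p n x z * p z y

/-- Green function of the kernel `p`. -/
def kGreen {V : Type*} (p : V → V → ℝ) (x y : V) : ℝ :=
  ∑' n : ℕ, kerPow p n x y

/-- Outer vertex boundary of a set `S` in the graph `Gr`. -/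
def vBoundary {V : Type*} (Gr : SimpleGraph V) (S : Set V) : Set V :=
  {x : V | x ∉ S ∧ ∃ y ∈ S, Gr.Adj y x}

/-- Green-variation functional `Δ(S;a,b) = max_{x ∈ ∂S} |G(a,x)−G(b,x)|/G(a,x)`. -/
def kDelta {V : Type*} (Gr : SimpleGraph V) (p : V → V → ℝ) (S : Set V) (a b : V) : ℝ :=
  sSup ((fun x => |kGreen p a x - kGreen p b x| / kGreen p a x) '' vBoundary Gr S)

/-- `R(S;a,b) = dist({a,b}, ∂S)` in the graph metric, as a real number. -/
def kR {V : Type*} (Gr : SimpleGraph V) (S : Set V) (a b : V) : ℝ :=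
  sInf ((fun x => ((min (Gr.dist a x) (Gr.dist b x) : ℕ) : ℝ)) '' vBoundary Gr S)

/-- Near-diagonal threshold `n₋(r) = min {n ≥ 1 : ρ(n) ≥ r/κ}`. -/
def nMinus (ρ : ℕ → ℝ) (κ r : ℝ) : ℕ :=
  sInf {n : ℕ | 1 ≤ n ∧ r / κ ≤ ρ n}
/-- The iterates of a nonnegative kernel are nonnegative. -/
theorem kerPow_nonneg {V : Type*} {p : V → V → ℝ} (hp0 : ∀ x y, 0 ≤ p x y) (n : ℕ) (x y : V) :
    0 ≤ kerPow p n x y := by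
  induction n generalizing y with
  | zero =>
    dsimp only [kerPow]
    split_ifs <;> norm_num
  | succ n ih =>
    rw [kerPow]
    exact tsum_nonneg fun z => mul_nonneg (ih z) (hp0 z y)

/-- (Universal Hölder from (HK)+(IH).) There is `C_UH > 0` such
that `|p_n(a,x) − p_n(b,x)| ≤ C_UH (d(a,b)/ρ(n))^α Vol(ρ(n))⁻¹` for all `n ≥ 1`. -/
theorem universal_holder_from_HK_IH
    {V : Type*} (Gr : SimpleGraph V) (hconn : Gr.Connected)
    (hbdeg : ∃ D : ℕ, ∀ v : V, (Gr.neighborSet v).ncard ≤ D)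
    (p : V → V → ℝ)
    (hp0 : ∀ x y, 0 ≤ p x y) (hpsym : ∀ x y, p x y = p y x)
    (hrow : ∀ x, HasSum (p x) 1)
    (hlazy : ∃ ε > 0, ∀ x, ε ≤ p x x)
    (hirr : ∀ x y : V, ∃ n : ℕ, 0 < kerPow p n x y)
    (ρ : ℕ → ℝ) (hρpos : ∀ n, 1 ≤ n → 0 < ρ n)
    (hρmono : StrictMonoOn ρ {n : ℕ | 1 ≤ n}) (hρtop : Tendsto ρ atTop atTop)
    (Vol : ℝ → ℝ) (hVpos : ∀ r : ℝ, 0 < r → 0 < Vol r)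
    (hVmono : MonotoneOn Vol (Set.Ioi 0))
    (κ : ℝ) (hκ : 0 < κ)
    -- (HK)
    (c₀ C₀ : ℝ) (hc₀ : 0 < c₀) (hC₀ : 0 < C₀)
    (hHKu : ∀ n, 1 ≤ n → ∀ x y : V, kerPow p n x y ≤ C₀ / Vol (ρ n))
    (hHKl : ∀ n, 1 ≤ n → ∀ x y : V, (Gr.dist x y : ℝ) ≤ κ * ρ n →
      c₀ / Vol (ρ n) ≤ kerPow p n x y)
    -- (IH)
    (θ α C_H : ℝ) (hθ : 0 < θ) (hθκ : θ ≤ κ / 4) (hα : 0 < α) (hα1 : α ≤ 1) (hCH : 0 < C_H)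
    (hIH : ∀ n, 1 ≤ n → ∀ z₀ y z z' : V,
      (Gr.dist z₀ z : ℝ) ≤ θ * ρ n → (Gr.dist z₀ z' : ℝ) ≤ θ * ρ n →
      |kerPow p n z y - kerPow p n z' y| ≤
        C_H * ((Gr.dist z z' : ℝ) / ρ n) ^ α *
          sSup ((fun w => kerPow p n w y) '' {w : V | (Gr.dist z₀ w : ℝ) ≤ θ * ρ n})) :
    ∃ C_UH > 0, ∀ n, 1 ≤ n → ∀ x a b : V,
      |kerPow p n a x - kerPow p n b x| ≤
        C_UH * ((Gr.dist a b : ℝ) / ρ n) ^ α * (Vol (ρ n))⁻¹ := by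
  have hnonneg := kerPow_nonneg hp0
  have hθα : 0 < θ ^ α := Real.rpow_pos_of_pos hθ α
  refine ⟨C_H * C₀ + C₀ / θ ^ α, by positivity, fun n hn x a b => ?_⟩
  have hρ := hρpos n hn
  have hV := hVpos _ hρ
  have hratio : 0 ≤ ((Gr.dist a b : ℝ) / ρ n) ^ α := by positivity
  rcases le_or_gt (Gr.dist a b : ℝ) (θ * ρ n) with hab | hab
  · have haa : (Gr.dist a a : ℝ) ≤ θ * ρ n := by
      rw [SimpleGraph.dist_self]
      push_cast
      positivity
    have hsup : sSup ((fun w => kerPow p n w x) '' {w : V | (Gr.dist a w : ℝ) ≤ θ * ρ n}) ≤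
        C₀ / Vol (ρ n) := by
      refine csSup_le (Set.Nonempty.image _ ⟨a, haa⟩) ?_
      rintro _ ⟨w, -, rfl⟩
      exact hHKu n hn w x
    calc |kerPow p n a x - kerPow p n b x|
        ≤ C_H * ((Gr.dist a b : ℝ) / ρ n) ^ α * (C₀ / Vol (ρ n)) :=
          (hIH n hn a x a b haa hab).trans (by gcongr)
      _ = C_H * C₀ * ((Gr.dist a b : ℝ) / ρ n) ^ α * (Vol (ρ n))⁻¹ := by ring
      _ ≤ _ := by
          gcongr
          exact le_add_of_nonneg_right (by positivity)
  · have hθle : θ ^ α ≤ ((Gr.dist a b : ℝ) / ρ n) ^ α :=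
      Real.rpow_le_rpow hθ.le ((le_div_iff₀ hρ).2 hab.le) hα.le
    calc |kerPow p n a x - kerPow p n b x|
        ≤ C₀ / Vol (ρ n) :=
          abs_sub_le_of_nonneg_of_le (hnonneg n a x) (hHKu n hn a x)
            (hnonneg n b x) (hHKu n hn b x)
      _ = C₀ / θ ^ α * θ ^ α * (Vol (ρ n))⁻¹ := by field_simp
      _ ≤ C₀ / θ ^ α * ((Gr.dist a b : ℝ) / ρ n) ^ α * (Vol (ρ n))⁻¹ := by gcongr
      _ ≤ _ := by
          gcongr
          exact le_add_of_nonneg_left (by positivity)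
end
end

section
/- Let ρ : {1,2,…} → (0,∞) and Vol : (0,∞) → (0,∞) satisfy Vol(r) ≍ r^{d*} and ρ(n) ≍ n^{1/γ} with d*/γ > 1, and fix κ > 0 with n₋(r) = min{n : ρ(n) ≥ r/κ}. Suppose Φ : [0,∞) → (0,1] is nonincreasing and satisfies Φ(t) ≤ C exp(−c t^η) for all t ≥ 0, for some constants c, C, η > 0. Then for every α ∈ (0,1] condition (TR_α) holds: there exists C_T > 0 such that for all r ≥ 1, with m = n₋(r), ∑_{1≤n<m} Vol(ρ(n))^{-1} ρ(n)^{-α} Φ(r/(2ρ(n))) ≤ C_T ρ(m)^{-α} ∑_{n≥m} Vol(ρ(n))^{-1}. -/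
open Filter Topology

noncomputable section

/-- A stretched exponential is dominated by every inverse power. -/
theorem exists_exp_neg_mul_rpow_le_rpow_neg {c η q : ℝ} (hc : 0 < c) (hη : 0 < η) (hq : 0 < q) :
    ∃ K > 0, ∀ t : ℝ, 0 < t → Real.exp (-(c * t ^ η)) ≤ K * t ^ (-q) := by
  refine ⟨((c * η / q) ^ (q / η))⁻¹, by positivity, fun t ht => ?_⟩
  rw [Real.exp_neg, Real.rpow_neg ht.le, ← mul_inv]
  refine inv_anti₀ (by positivity) ?_
  calc (c * η / q) ^ (q / η) * t ^ q = (c * η / q * t ^ η) ^ (q / η) := by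
        rw [Real.mul_rpow (by positivity) (by positivity), ← Real.rpow_mul ht.le]
        congr 2
        field_simp
    _ ≤ Real.exp (c * η / q * t ^ η) ^ (q / η) := by
        refine Real.rpow_le_rpow (by positivity) ?_ (by positivity)
        linarith [Real.add_one_le_exp (c * η / q * t ^ η)]
    _ = Real.exp (c * t ^ η) := by
        rw [← Real.exp_mul]
        congr 1
        field_simp

/-- Power bounds on a monotone positive function extend from `[1, ∞)` to any `[s₀, ∞)`, `s₀ > 0`. -/
theorem exists_rpow_bounds_of_one_le {V : ℝ → ℝ} {d a A s₀ : ℝ} (hd : 0 < d)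
    (hmono : MonotoneOn V (Set.Ioi 0)) (hpos : ∀ s : ℝ, 0 < s → 0 < V s)
    (ha : 0 < a) (haA : a ≤ A)
    (hV : ∀ s : ℝ, 1 ≤ s → a * s ^ d ≤ V s ∧ V s ≤ A * s ^ d) (hs₀ : 0 < s₀) :
    ∃ b > 0, ∃ B > 0, ∀ s : ℝ, s₀ ≤ s → b * s ^ d ≤ V s ∧ V s ≤ B * s ^ d := by
  have hA : 0 < A := ha.trans_le haA
  have hVs₀ := hpos s₀ hs₀
  refine ⟨min a (V s₀), lt_min ha hVs₀, max A (A * (s₀ ^ d)⁻¹), lt_max_of_lt_left hA,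
    fun s hs => ?_⟩
  have hs_pos : 0 < s := hs₀.trans_le hs
  have hsd : 0 ≤ s ^ d := by positivity
  rcases le_total 1 s with h1 | h1
  · exact ⟨(mul_le_mul_of_nonneg_right (min_le_left _ _) hsd).trans (hV s h1).1,
      (hV s h1).2.trans (mul_le_mul_of_nonneg_right (le_max_left _ _) hsd)⟩
  · constructor
    · calc min a (V s₀) * s ^ d ≤ V s₀ * 1 :=
            mul_le_mul (min_le_right _ _) (Real.rpow_le_one hs_pos.le h1 hd.le) hsd hVs₀.le
        _ ≤ V s := by rw [mul_one]; exact hmono hs₀ hs_pos hs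
    · calc V s ≤ V 1 := hmono hs_pos (Set.mem_Ioi.2 one_pos) h1
        _ ≤ A := by simpa using (hV 1 le_rfl).2
        _ = A * (s₀ ^ d)⁻¹ * s₀ ^ d := by field_simp
        _ ≤ max A (A * (s₀ ^ d)⁻¹) * s ^ d :=
            mul_le_mul (le_max_right _ _) (Real.rpow_le_rpow hs₀.le hs hd.le)
              (by positivity) (hA.le.trans (le_max_left _ _))

theorem one_le_nMinus {ρ : ℕ → ℝ} (hρ : Tendsto ρ atTop atTop) (κ r : ℝ) :
    1 ≤ nMinus ρ κ r := by
  obtain ⟨n, hn⟩ := ((eventually_ge_atTop 1).and (hρ.eventually_ge_atTop (r / κ))).exists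
  exact (Nat.sInf_mem (s := {n : ℕ | 1 ≤ n ∧ r / κ ≤ ρ n}) ⟨n, hn⟩).1

theorem lt_of_lt_nMinus {ρ : ℕ → ℝ} {κ r : ℝ} {n : ℕ} (hn : 1 ≤ n) (h : n < nMinus ρ κ r) :
    ρ n < r / κ := by
  by_contra! hle
  exact Nat.notMem_of_lt_sInf h ⟨hn, hle⟩

/-- Power growth of `ρ` keeps the scales up to twice the threshold comparable to `r`. -/
theorem le_mul_of_lt_two_mul_nMinus {ρ : ℕ → ℝ} {κ r a A p : ℝ} (ha : 0 < a) (hA : 0 < A)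
    (hp : 0 ≤ p)
    (hρ : ∀ n : ℕ, 1 ≤ n → a * (n : ℝ) ^ p ≤ ρ n ∧ ρ n ≤ A * (n : ℝ) ^ p)
    (hm : 2 ≤ nMinus ρ κ r) {n : ℕ} (hn : 1 ≤ n) (hnm : n < 2 * nMinus ρ κ r) :
    ρ n ≤ A / a * 4 ^ p / κ * r := by
  obtain ⟨k, hk⟩ : ∃ k, nMinus ρ κ r = k + 1 := ⟨nMinus ρ κ r - 1, by omega⟩
  have hk1 : 1 ≤ k := by omega
  have hnk : (n : ℝ) ≤ 4 * k := by exact_mod_cast (by omega : n ≤ 4 * k)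
  have hρk : ρ k < r / κ := lt_of_lt_nMinus hk1 (by omega)
  calc ρ n ≤ A * (n : ℝ) ^ p := (hρ n hn).2
    _ ≤ A * (4 * k : ℝ) ^ p := by gcongr
    _ = A / a * 4 ^ p * (a * (k : ℝ) ^ p) := by
        rw [Real.mul_rpow (by norm_num) (by positivity)]
        field_simp
    _ ≤ A / a * 4 ^ p * (r / κ) := by
        gcongr
        exact (hρ k hk1).1.trans hρk.le
    _ = A / a * 4 ^ p / κ * r := by ring

/-- The reciprocals of a function of power growth with exponent above one have summable tails. -/
theorem summable_tail_inv_of_rpow_le {v : ℕ → ℝ} {a p : ℝ} (ha : 0 < a) (hp : 1 < p)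
    (hv : ∀ n : ℕ, 1 ≤ n → a * (n : ℝ) ^ p ≤ v n) {m : ℕ} (hm : 1 ≤ m) :
    Summable fun n : ℕ => if m ≤ n then (v n)⁻¹ else 0 := by
  have hlow : ∀ n : ℕ, 1 ≤ n → 0 < a * (n : ℝ) ^ p := fun n hn => by
    have : (0 : ℝ) < n := by exact_mod_cast hn
    positivity
  refine Summable.of_nonneg_of_le (fun n => ?_) (fun n => ?_)
    ((Real.summable_nat_rpow_inv.2 hp).mul_left a⁻¹)
  · split_ifs with h
    · exact inv_nonneg.2 ((hlow n (hm.trans h)).le.trans (hv n (hm.trans h)))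
    · exact le_rfl
  · split_ifs with h
    · rw [← mul_inv]
      exact inv_anti₀ (hlow n (hm.trans h)) (hv n (hm.trans h))
    · positivity

/-- Ahlfors scales plus a stretched-exponential envelope imply
(TR_α) for every `α ∈ (0,1]`. -/
theorem TR_alpha_of_ahlfors_stretched_exponential
    (ρ : ℕ → ℝ) (Vol : ℝ → ℝ) (dstar γ κ : ℝ)
    (hdstar : 0 < dstar) (hγ : 0 < γ) (hdγ : 1 < dstar / γ) (hκ : 0 < κ)
    (hρmono : StrictMonoOn ρ {n : ℕ | 1 ≤ n})
    (hρtop : Tendsto ρ atTop atTop)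
    (hρpos : ∀ n : ℕ, 1 ≤ n → 0 < ρ n)
    (hVmono : MonotoneOn Vol (Set.Ioi 0))
    (hVpos : ∀ r : ℝ, 0 < r → 0 < Vol r)
    -- `Vol(r) ≍ r^{d*}` for `r ≥ 1`
    (cV CV : ℝ) (hcV : 0 < cV) (hcVCV : cV ≤ CV)
    (hVol : ∀ r : ℝ, 1 ≤ r → cV * r ^ dstar ≤ Vol r ∧ Vol r ≤ CV * r ^ dstar)
    -- `ρ(n) ≍ n^{1/γ}` for `n ≥ 1`
    (cρ Cρ : ℝ) (hcρ : 0 < cρ) (hcρCρ : cρ ≤ Cρ)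
    (hρest : ∀ n : ℕ, 1 ≤ n →
      cρ * (n : ℝ) ^ (1 / γ) ≤ ρ n ∧ ρ n ≤ Cρ * (n : ℝ) ^ (1 / γ))
    -- the envelope `Φ`
    (Φ : ℝ → ℝ) (hΦanti : AntitoneOn Φ (Set.Ici 0))
    (hΦrange : ∀ t : ℝ, 0 ≤ t → 0 < Φ t ∧ Φ t ≤ 1)
    (c C η : ℝ) (hc : 0 < c) (hC : 0 < C) (hη : 0 < η)
    (hΦbd : ∀ t : ℝ, 0 ≤ t → Φ t ≤ C * Real.exp (-(c * t ^ η))) :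
    ∀ α : ℝ, 0 < α → α ≤ 1 → ∃ C_T > 0, ∀ r : ℝ, 1 ≤ r →
      (∑' n : ℕ, if 1 ≤ n ∧ n < nMinus ρ κ r then
          (Vol (ρ n))⁻¹ * (ρ n) ^ (-α) * Φ (r / (2 * ρ n)) else 0)
        ≤ C_T * (ρ (nMinus ρ κ r)) ^ (-α) *
            ∑' n : ℕ, if nMinus ρ κ r ≤ n then (Vol (ρ n))⁻¹ else 0 := by
  intro α hα _
  have hCρ : 0 < Cρ := hcρ.trans_le hcρCρ
  obtain ⟨a, ha, A, hA, hVρ⟩ :=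
    exists_rpow_bounds_of_one_le hdstar hVmono hVpos hcV hcVCV hVol (hρpos 1 le_rfl)
  have hρ1 : ∀ n : ℕ, 1 ≤ n → ρ 1 ≤ ρ n := fun n hn =>
    hρmono.monotoneOn (by simp) hn hn
  obtain ⟨K, hK, hexp⟩ :=
    exists_exp_neg_mul_rpow_le_rpow_neg hc hη (add_pos hdstar hα)
  set D : ℝ := Cρ / cρ * 4 ^ (1 / γ) / κ
  have hD : 0 < D := by positivity
  set L : ℝ := a⁻¹ * (C * K * 2 ^ (dstar + α)) with hL_def
  have hL : 0 < L := by positivity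
  refine ⟨L * A * D ^ (dstar + α), by positivity, fun r hr => ?_⟩
  have hr0 : 0 < r := one_pos.trans_le hr
  have hm1 := one_le_nMinus hρtop κ r
  have hnear := fun (hm2 : 2 ≤ nMinus ρ κ r) (n : ℕ) (hn : 1 ≤ n) =>
    le_mul_of_lt_two_mul_nMinus hcρ hCρ (by positivity : 0 ≤ 1 / γ) hρest hm2 hn
  set m := nMinus ρ κ r
  have hVlow : ∀ n : ℕ, 1 ≤ n → a * cρ ^ dstar * (n : ℝ) ^ (dstar / γ) ≤ Vol (ρ n) := by
    intro n hn
    calc a * cρ ^ dstar * (n : ℝ) ^ (dstar / γ) = a * (cρ * (n : ℝ) ^ (1 / γ)) ^ dstar := by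
          rw [Real.mul_rpow hcρ.le (by positivity), ← Real.rpow_mul (by positivity),
            one_div_mul_eq_div, mul_assoc]
      _ ≤ a * ρ n ^ dstar := by
          gcongr
          exact (hρest n hn).1
      _ ≤ Vol (ρ n) := (hVρ _ (hρ1 n hn)).1
  have hsum := summable_tail_inv_of_rpow_le (v := fun n => Vol (ρ n))
    (by positivity) hdγ hVlow hm1
  have htail : ∀ n : ℕ, 0 ≤ if m ≤ n then (Vol (ρ n))⁻¹ else 0 := fun n => by
    split_ifs with h
    · exact (inv_pos.2 (hVpos _ (hρpos n (hm1.trans h)))).le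
    · exact le_rfl
  have hρm := hρpos m hm1
  rcases hm1.eq_or_lt with hm | hm2
  · have hzero : ∀ n : ℕ, ¬(1 ≤ n ∧ n < m) := by omega
    simp only [hzero, if_false, tsum_zero]
    exact mul_nonneg (by positivity) (tsum_nonneg htail)
  have hterm : ∀ n : ℕ, 1 ≤ n →
      (Vol (ρ n))⁻¹ * ρ n ^ (-α) * Φ (r / (2 * ρ n)) ≤ L * r ^ (-(dstar + α)) := by
    intro n hn
    have hρn := hρpos n hn
    have ht : 0 < r / (2 * ρ n) := by positivity
    have hΦ : Φ (r / (2 * ρ n)) ≤ C * (K * (r / (2 * ρ n)) ^ (-(dstar + α))) :=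
      (hΦbd _ ht.le).trans (mul_le_mul_of_nonneg_left (hexp _ ht) hC.le)
    have hV : (Vol (ρ n))⁻¹ ≤ (a * ρ n ^ dstar)⁻¹ :=
      inv_anti₀ (by positivity) (hVρ _ (hρ1 n hn)).1
    calc (Vol (ρ n))⁻¹ * ρ n ^ (-α) * Φ (r / (2 * ρ n))
        ≤ (a * ρ n ^ dstar)⁻¹ * ρ n ^ (-α) * (C * (K * (r / (2 * ρ n)) ^ (-(dstar + α)))) :=
          mul_le_mul (mul_le_mul_of_nonneg_right hV (by positivity)) hΦ
            (hΦrange _ ht.le).1.le (by positivity)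
      _ = L * r ^ (-(dstar + α)) := by
          rw [Real.div_rpow hr0.le (by positivity), Real.mul_rpow (by norm_num) hρn.le,
            Real.rpow_neg hρn.le, Real.rpow_neg hρn.le, Real.rpow_neg (by norm_num : (0:ℝ) ≤ 2),
            Real.rpow_add hρn, hL_def]
          field_simp
  have hleft : (∑' n : ℕ, if 1 ≤ n ∧ n < m then
      (Vol (ρ n))⁻¹ * ρ n ^ (-α) * Φ (r / (2 * ρ n)) else 0) ≤
      m * (L * r ^ (-(dstar + α))) := by
    rw [tsum_eq_sum (s := Finset.range m)
      (fun n hn => if_neg fun h => hn (Finset.mem_range.2 h.2))]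
    refine (Finset.sum_le_card_nsmul _ _ (L * r ^ (-(dstar + α))) fun n _ => ?_).trans_eq
      (by rw [Finset.card_range, nsmul_eq_mul])
    split_ifs with h
    · exact hterm n h.1
    · positivity
  have hright : m * (A * (D * r) ^ dstar)⁻¹ ≤
      ∑' n : ℕ, if m ≤ n then (Vol (ρ n))⁻¹ else 0 := by
    refine le_trans ?_ (hsum.sum_le_tsum (Finset.Ico m (2 * m)) fun n _ => htail n)
    have hcard : (Finset.Ico m (2 * m)).card = m := by rw [Nat.card_Ico]; omega
    rw [← nsmul_eq_mul]
    nth_rewrite 1 [← hcard]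
    refine Finset.card_nsmul_le_sum _ _ _ fun n hn => ?_
    obtain ⟨hmn, hn2⟩ := Finset.mem_Ico.1 hn
    have hn1 := hm1.trans hmn
    have hρn := hρpos n hn1
    rw [if_pos hmn]
    refine inv_anti₀ (hVpos _ hρn) ((hVρ _ (hρ1 n hn1)).2.trans ?_)
    gcongr
    exact hnear hm2 n hn1 hn2
  have hρm_le : (D * r) ^ (-α) ≤ ρ m ^ (-α) :=
    Real.rpow_le_rpow_of_nonpos hρm (hnear hm2 m hm1 (by omega)) (by linarith)
  calc _ ≤ m * (L * r ^ (-(dstar + α))) := hleft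
    _ = L * A * D ^ (dstar + α) * (D * r) ^ (-α) * (m * (A * (D * r) ^ dstar)⁻¹) := by
        rw [Real.rpow_neg hr0.le, Real.rpow_neg (by positivity), Real.mul_rpow hD.le hr0.le,
          Real.mul_rpow hD.le hr0.le, Real.rpow_add hr0, Real.rpow_add hD]
        field_simp
    _ ≤ _ := by gcongr
end
end
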